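/- arXiv:1406.0096 — 2 statements merged into one kernel-verified Lean document; each statement's English description precedes it below -/
import Mathlib

section
/- Let P_Θ be a locally finite marked point set in ℝ² satisfying Conditions D and admitting no descending chain of Type 1, and define the T₁-iterates f₀:=0, f_{n+1}:=T₁f_n with monotone limits f and g. Then f = g. -/
open scoped ENNReal
open Real

noncomputable section

namespace Lilypond

/-- Points of the Euclidean plane. -/
abbrev Pt := EuclideanSpace ℝ (Fin 2)

/-- A marked point: a centre in the plane together with a direction. -/
abbrev MPt := Pt × ℝ

/-- The unit vector in direction `θ`. -/
def dirVec (θ : ℝ) : Pt := (WithLp.equiv 2 (Fin 2 → ℝ)).symm ![Real.cos θ, Real.sin θ]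

/-- The full line through the centre of `p` in the direction of `p`. -/
def lineThru (p : MPt) : Set Pt := {q | ∃ t : ℝ, q = p.1 + t • dirVec p.2}

open Classical in
/-- A point of intersection of the lines through `i` and `j` (junk value if disjoint). -/
def interPt (i j : MPt) : Pt :=
  if h : (lineThru i ∩ lineThru j).Nonempty then h.choose else 0

open Classical in
/-- The distance `dᵢⱼ` from the centre of `i` to the intersection point of the lines
through `i` and `j`; if the directions coincide it is half the distance between the centres
when `j` lies on the line through `i`, and `∞` otherwise. -/
def dD (i j : MPt) : ℝ≥0∞ :=
  if i.2 = j.2 then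
    (if j.1 ∈ lineThru i then edist i.1 j.1 / 2 else ⊤)
  else edist i.1 (interPt i j)

/-- `A` is a locally finite marked point set: all directions lie in `[0, π)` and only finitely
many centres lie in any bounded region. -/
def MarkedLocFin (A : Set MPt) : Prop :=
  (∀ p ∈ A, p.2 ∈ Set.Ico 0 Real.pi) ∧
    ∀ B : Set Pt, Bornology.IsBounded B → {p ∈ A | p.1 ∈ B}.Finite

/-- Conditions D: all finite distances `dᵢⱼ` (`i ≠ j`) are mutually distinct. -/
def CondD (A : Set MPt) : Prop :=
  ∀ i ∈ A, ∀ j ∈ A, ∀ k ∈ A, ∀ l ∈ A,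
    i ≠ j → k ≠ l → (i, j) ≠ (k, l) → dD i j ≠ ⊤ → dD k l ≠ ⊤ → dD i j ≠ dD k l

/-- The set `Dᵢ(f)` of Model 1. -/
def D1 (A : Set MPt) (f : MPt → ℝ≥0∞) (i : MPt) : Set ℝ≥0∞ :=
  {x | ∃ j ∈ A, j ≠ i ∧ x = dD i j ∧ dD j i < dD i j ∧ dD j i < f j}

/-- The operator `T₁` of Model 1 (with `sInf ∅ = ∞`). -/
def T1 (A : Set MPt) (f : MPt → ℝ≥0∞) (i : MPt) : ℝ≥0∞ := sInf (D1 A f i)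

/-- The set `D⁽²⁾ᵢ(f)` of Model 2. -/
def D2 (A : Set MPt) (f : MPt → ℝ≥0∞) (i : MPt) : Set ℝ≥0∞ :=
  {x | ∃ j ∈ A, j ≠ i ∧ x = max (dD i j) (dD j i) ∧ dD j i ≤ f j}

/-- The operator `T₂` of Model 2 (with `sInf ∅ = ∞`). -/
def T2 (A : Set MPt) (f : MPt → ℝ≥0∞) (i : MPt) : ℝ≥0∞ := sInf (D2 A f i)

/-- The relative interior of the segment of half-length `r` centred at `p`. -/
def S0 (p : MPt) (r : ℝ≥0∞) : Set Pt :=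
  {q | ∃ t : ℝ, ENNReal.ofReal |t| < r ∧ q = p.1 + t • dirVec p.2}

/-- `f` is a hard-segment (HS) function on `A`. -/
def IsHS (A : Set MPt) (f : MPt → ℝ≥0∞) : Prop :=
  ∀ i ∈ A, ∀ j ∈ A, i ≠ j → Disjoint (S0 i (f i)) (S0 j (f j))

/-- `j` is a Type 1 stopping segment neighbour of `i` for `f`. -/
def StopNbr1 (A : Set MPt) (f : MPt → ℝ≥0∞) (i j : MPt) : Prop :=
  j ∈ A ∧ j ≠ i ∧ f i = dD i j ∧ dD j i < dD i j ∧ dD j i < f j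

/-- `f` is a GMHS function of Type 1 on `A`. -/
def IsGMHS1 (A : Set MPt) (f : MPt → ℝ≥0∞) : Prop :=
  IsHS A f ∧ ∀ i ∈ A, f i < ⊤ → ∃ j, StopNbr1 A f i j

/-- `j` is a Type 2 stopping segment neighbour of `i` for `f`. -/
def StopNbr2 (A : Set MPt) (f : MPt → ℝ≥0∞) (i j : MPt) : Prop :=
  j ∈ A ∧ j ≠ i ∧ f i = max (dD i j) (dD j i) ∧ dD j i ≤ f j

/-- `f` is a GMHS function of Type 2 on `A`. -/
def IsGMHS2 (A : Set MPt) (f : MPt → ℝ≥0∞) : Prop :=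
  IsHS A f ∧ ∀ i ∈ A, f i < ⊤ → ∃ j, StopNbr2 A f i j

/-- `A` has a descending chain of Type 1. -/
def HasDescChain1 (A : Set MPt) : Prop :=
  ∃ P : ℕ → MPt, (∀ n, P n ∈ A) ∧ Function.Injective P ∧
    dD (P 0) (P 1) < ⊤ ∧
    ∀ n : ℕ, dD (P (n+1)) (P n) ≤ dD (P n) (P (n+1)) ∧
      dD (P (n+1)) (P (n+2)) ≤ dD (P (n+1)) (P n)

/-- `A` has a descending chain of Type 2. -/
def HasDescChain2 (A : Set MPt) : Prop :=
  ∃ P : ℕ → MPt, (∀ n, P n ∈ A) ∧ Function.Injective P ∧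
    dD (P 1) (P 0) < ⊤ ∧
    ∀ n : ℕ, max (dD (P (n+1)) (P (n+2))) (dD (P (n+2)) (P (n+1))) ≤ dD (P (n+1)) (P n)

/-- The `T₁`-iterates `f₀ := 0`, `f_{n+1} := T₁ f_n`. -/
def iter1 (A : Set MPt) : ℕ → MPt → ℝ≥0∞
  | 0 => fun _ => 0
  | n + 1 => T1 A (iter1 A n)

/-- The monotone limit `f` of the even `T₁`-iterates. -/
def limEven1 (A : Set MPt) (p : MPt) : ℝ≥0∞ := ⨆ n, iter1 A (2 * n) p

/-- The monotone limit `g` of the odd `T₁`-iterates. -/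
def limOdd1 (A : Set MPt) (p : MPt) : ℝ≥0∞ := ⨅ n, iter1 A (2 * n + 1) p

/-- The `T₂`-iterates `f₀ := 0`, `f_{n+1} := T₂ f_n`. -/
def iter2 (A : Set MPt) : ℕ → MPt → ℝ≥0∞
  | 0 => fun _ => 0
  | n + 1 => T2 A (iter2 A n)

/-- The monotone limit `f` of the even `T₂`-iterates. -/
def limEven2 (A : Set MPt) (p : MPt) : ℝ≥0∞ := ⨆ n, iter2 A (2 * n) p

/-- The monotone limit `g` of the odd `T₂`-iterates. -/
def limOdd2 (A : Set MPt) (p : MPt) : ℝ≥0∞ := ⨅ n, iter2 A (2 * n + 1) p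

lemma interPt_comm (i j : MPt) : interPt i j = interPt j i := by
  unfold interPt
  rw [Set.inter_comm (lineThru i) (lineThru j)]

lemma edist_le_dD_add_dD (i j : MPt) : edist i.1 j.1 ≤ dD i j + dD j i := by
  unfold dD
  by_cases h : i.2 = j.2
  · rw [if_pos h, if_pos h.symm]
    split_ifs
    · rw [edist_comm j.1 i.1, ENNReal.add_halves]
    all_goals simp
  · rw [if_neg h, if_neg (Ne.symm h), interPt_comm j i, edist_comm j.1]
    exact edist_triangle _ _ _

lemma MarkedLocFin.finite_dD_le {A : Set MPt} (hA : MarkedLocFin A) (i : MPt) {R : ℝ≥0∞}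
    (hR : R < ⊤) : {j ∈ A | dD j i < dD i j ∧ dD i j ≤ R}.Finite := by
  have hb : Bornology.IsBounded {q : Pt | edist i.1 q ≤ R + R} := by
    refine (Metric.isBounded_closedBall (x := i.1) (r := (R + R).toReal)).subset fun q hq => ?_
    rw [Metric.mem_closedBall, dist_comm, dist_edist]
    exact ENNReal.toReal_mono (ENNReal.add_lt_top.2 ⟨hR, hR⟩).ne hq
  refine (hA.2 _ hb).subset fun j hj => ⟨hj.1, ?_⟩
  exact (edist_le_dD_add_dD i j).trans (add_le_add hj.2.2 (hj.2.1.le.trans hj.2.2))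

lemma exists_T1_eq {A : Set MPt} (hA : MarkedLocFin A) {f : MPt → ℝ≥0∞} {i : MPt}
    (h : T1 A f i < ⊤) :
    ∃ j ∈ A, j ≠ i ∧ T1 A f i = dD i j ∧ dD j i < dD i j ∧ dD j i < f j := by
  obtain ⟨x, hx, hxt⟩ := sInf_lt_iff.1 h
  have hfin : (D1 A f i ∩ Set.Iic x).Finite := by
    refine ((hA.finite_dD_le i hxt).image (dD i)).subset ?_
    rintro _ ⟨⟨j, hj, -, rfl, hlt, -⟩, hle⟩
    exact ⟨j, ⟨hj, hlt, hle⟩, rfl⟩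
  have hmem := Set.Nonempty.csInf_mem (s := D1 A f i ∩ Set.Iic x) ⟨x, hx, le_refl x⟩ hfin
  have heq : T1 A f i = sInf (D1 A f i ∩ Set.Iic x) := by
    refine le_antisymm (sInf_le hmem.1) (le_sInf fun y hy => ?_)
    rcases le_total y x with hyx | hyx
    · exact sInf_le ⟨hy, hyx⟩
    · exact hmem.2.trans hyx
  rw [← heq] at hmem
  exact hmem.1

lemma T1_antitone (A : Set MPt) : Antitone (T1 A) := by
  intro f g hfg i
  refine sInf_le_sInf ?_
  rintro x ⟨j, hj, hne, hx, hlt, hf⟩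
  exact ⟨j, hj, hne, hx, hlt, hf.trans_le (hfg j)⟩

lemma iter1_two_mul_le (A : Set MPt) (n : ℕ) : iter1 A (2 * n) ≤ iter1 A (2 * n + 2) := by
  induction n with
  | zero => exact fun p => zero_le
  | succ n ih => exact T1_antitone A (T1_antitone A ih)

lemma monotone_iter1_even (A : Set MPt) : Monotone fun n => iter1 A (2 * n) :=
  monotone_nat_of_le_succ (iter1_two_mul_le A)

lemma antitone_iter1_odd (A : Set MPt) : Antitone fun n => iter1 A (2 * n + 1) :=
  fun _ _ h => T1_antitone A (monotone_iter1_even A h)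

lemma limEven1_le_limOdd1 (A : Set MPt) (p : MPt) : limEven1 A p ≤ limOdd1 A p := by
  have key (n : ℕ) : iter1 A (2 * n) ≤ iter1 A (2 * n + 1) := by
    induction n with
    | zero => exact fun p => zero_le
    | succ n ih => exact T1_antitone A (T1_antitone A ih)
  refine iSup_le fun m => le_iInf fun n => ?_
  calc iter1 A (2 * m) p ≤ iter1 A (2 * max m n) p := monotone_iter1_even A (le_max_left m n) p
    _ ≤ iter1 A (2 * max m n + 1) p := key _ p
    _ ≤ iter1 A (2 * n + 1) p := antitone_iter1_odd A (le_max_right m n) p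

lemma limOdd1_le_T1_limEven1 (A : Set MPt) (i : MPt) : limOdd1 A i ≤ T1 A (limEven1 A) i := by
  refine le_sInf ?_
  rintro _ ⟨j, hj, hne, rfl, hlt, hf⟩
  obtain ⟨n, hn⟩ := lt_iSup_iff.1 hf
  exact (iInf_le _ n).trans (sInf_le ⟨j, hj, hne, rfl, hlt, hn⟩)

lemma lt_limOdd1 {A : Set MPt} (hA : MarkedLocFin A) {j : MPt} {x : ℝ≥0∞} (hx : x < ⊤)
    (h : ∀ n, x < iter1 A (2 * n + 1) j) : x < limOdd1 A j := by
  rcases eq_or_lt_of_le (le_top (a := limOdd1 A j)) with htop | htop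
  · rwa [htop]
  obtain ⟨N, hN⟩ := iInf_lt_iff.1 htop
  have hfin : (Set.range fun n => iter1 A (2 * (N + n) + 1) j).Finite := by
    refine ((hA.finite_dD_le j hN).image (dD j)).subset ?_
    rintro _ ⟨n, rfl⟩
    have hle : iter1 A (2 * (N + n) + 1) j ≤ iter1 A (2 * N + 1) j :=
      antitone_iter1_odd A (Nat.le_add_right N n) j
    obtain ⟨k, hk, -, heq, hlt, -⟩ :=
      exists_T1_eq hA (f := iter1 A (2 * (N + n))) (hle.trans_lt hN)
    exact ⟨k, ⟨hk, hlt, heq.symm.trans_le hle⟩, heq.symm⟩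
  obtain ⟨k, hk⟩ := (Set.range_nonempty _).csInf_mem hfin
  refine (h (N + k)).trans_le (le_iInf fun n => ?_)
  refine hk.trans_le ((sInf_le (Set.mem_range_self n)).trans ?_)
  exact antitone_iter1_odd A (Nat.le_add_left n N) j

lemma T1_limOdd1_le_limEven1 {A : Set MPt} (hA : MarkedLocFin A) (i : MPt) :
    T1 A (limOdd1 A) i ≤ limEven1 A i := by
  rcases eq_or_lt_of_le (le_top (a := limEven1 A i)) with htop | htop
  · rw [htop]
    exact le_top
  have hle (n : ℕ) : iter1 A (2 * (n + 1)) i ≤ limEven1 A i :=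
    le_iSup (fun n => iter1 A (2 * n) i) (n + 1)
  have hex (n : ℕ) :=
    exists_T1_eq hA (f := iter1 A (2 * n + 1)) (i := i) ((hle n).trans_lt htop)
  choose J hJA hJne hJeq hJlt hJf using hex
  have hJle (n : ℕ) : dD i (J n) ≤ limEven1 A i := (hJeq n).symm.trans_le (hle n)
  have : Finite {j ∈ A | dD j i < dD i j ∧ dD i j ≤ limEven1 A i} := hA.finite_dD_le i htop
  obtain ⟨⟨j, hj, hlt, hjle⟩, hinf⟩ := Finite.exists_infinite_fiber
    (fun n => (⟨J n, hJA n, hJlt n, hJle n⟩ :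
      {j ∈ A | dD j i < dD i j ∧ dD i j ≤ limEven1 A i}))
  rw [Set.infinite_coe_iff] at hinf
  have hJj {n : ℕ} (hn : n ∈ (fun n => (⟨J n, hJA n, hJlt n, hJle n⟩ :
      {j ∈ A | dD j i < dD i j ∧ dD i j ≤ limEven1 A i})) ⁻¹' {⟨j, hj, hlt, hjle⟩}) :
      J n = j := congrArg Subtype.val hn
  have hne : j ≠ i := by
    obtain ⟨n, hn⟩ := hinf.nonempty
    exact hJj hn ▸ hJne n
  suffices hg : dD j i < limOdd1 A j from
    le_trans (sInf_le (show dD i j ∈ D1 A _ i from ⟨j, hj, hne, rfl, hlt, hg⟩)) hjle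
  refine lt_limOdd1 hA (hlt.trans_le le_top) fun n => ?_
  obtain ⟨m, hm, hnm⟩ := hinf.exists_gt n
  have hlt' := hJf m
  rw [hJj hm] at hlt'
  exact hlt'.trans_le (antitone_iter1_odd A hnm.le j)

lemma exists_next_of_limEven1_lt {A : Set MPt} (hA : MarkedLocFin A) {i : MPt}
    (h : limEven1 A i < limOdd1 A i) :
    ∃ j ∈ A, limEven1 A j < limOdd1 A j ∧ dD i j ≤ limEven1 A i ∧ dD j i < dD i j ∧
      limEven1 A j ≤ dD j i := by
  have hT := T1_limOdd1_le_limEven1 hA i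
  obtain ⟨j, hj, hne, heq, hlt, hg⟩ := exists_T1_eq hA (hT.trans_lt (h.trans_le le_top))
  rw [heq] at hT
  have hfj : limEven1 A j ≤ dD j i := by
    by_contra! hcon
    refine h.not_ge (((limOdd1_le_T1_limEven1 A i).trans ?_).trans hT)
    exact sInf_le ⟨j, hj, hne, rfl, hlt, hcon⟩
  refine ⟨j, hj, hfj.trans_lt hg, hT, hlt, hfj⟩

/-- Proposition 4.12: in the absence of descending chains of Type 1, the monotone limits
`f` and `g` of the `T₁`-iterates coincide on `P_Θ`. -/
theorem statement9 (A : Set MPt) (hA : MarkedLocFin A) (hD : CondD A)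
    (hchain : ¬ HasDescChain1 A) :
    Set.EqOn (limEven1 A) (limOdd1 A) A := by
  intro i hi
  refine le_antisymm (limEven1_le_limOdd1 A i) (not_lt.1 fun hlt => hchain ?_)
  let S := {p : MPt // p ∈ A ∧ limEven1 A p < limOdd1 A p}
  have hnext (p : S) : ∃ q : S, dD p q ≤ limEven1 A p ∧ dD q p < dD p q ∧
      limEven1 A q ≤ dD q p := by
    obtain ⟨j, hj, hjlt, h⟩ := exists_next_of_limEven1_lt hA p.2.2
    exact ⟨⟨j, hj, hjlt⟩, h⟩
  choose next hle hdlt hge using hnext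
  let P (n : ℕ) : S := next^[n] ⟨i, hi, hlt⟩
  have hP (n : ℕ) : P (n + 1) = next (P n) := Function.iterate_succ_apply' next n _
  have hanti : StrictAnti fun n => limEven1 A (P n) := by
    refine strictAnti_nat_of_succ_lt fun n => ?_
    rw [hP]
    exact (hge _).trans_lt ((hdlt _).trans_le (hle _))
  refine ⟨fun n => P n, fun n => (P n).2.1, fun m n hmn => hanti.injective ?_, ?_, fun n => ?_⟩
  · exact congrArg (limEven1 A) hmn
  · exact (hle (P 0)).trans_lt ((P 0).2.2.trans_le le_top)
  · beta_reduce
    rw [hP (n + 1), hP n]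
    exact ⟨(hdlt _).le, (hle _).trans (hge _)⟩

end Lilypond
end
end

section
/- Let P_Θ be a locally finite marked point set in ℝ² satisfying Conditions D, and let f∈𝓕 satisfy f = T₂f. Then f is a hard-segment (HS) function. -/
open scoped ENNReal
open Real

noncomputable section

namespace Lilypond

lemma norm_dirVec (θ : ℝ) : ‖dirVec θ‖ = 1 := by
  simp [dirVec, EuclideanSpace.norm_eq, Fin.sum_univ_two]

lemma edist_add_smul_dirVec (P : Pt) (t θ : ℝ) :
    edist P (P + t • dirVec θ) = ENNReal.ofReal |t| := by
  rw [edist_dist, dist_self_add_right, norm_smul, norm_dirVec, mul_one, Real.norm_eq_abs]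

/-- Distinct directions in `[0, π)` are linearly independent. -/
lemma eq_zero_of_smul_dirVec_eq {a b θ φ : ℝ} (hθ : θ ∈ Set.Ico 0 Real.pi)
    (hφ : φ ∈ Set.Ico 0 Real.pi) (hne : θ ≠ φ) (h : a • dirVec θ = b • dirVec φ) : a = 0 := by
  have h0 : a * Real.cos θ = b * Real.cos φ := by
    simpa [dirVec] using congrArg (fun v : Pt => v 0) h
  have h1 : a * Real.sin θ = b * Real.sin φ := by
    simpa [dirVec] using congrArg (fun v : Pt => v 1) h
  have hs : a * Real.sin (θ - φ) = 0 := by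
    rw [Real.sin_sub]
    linear_combination Real.cos φ * h1 - Real.sin φ * h0
  refine (mul_eq_zero.mp hs).resolve_right fun h => hne ?_
  have := (Real.sin_eq_zero_iff_of_lt_of_lt (by linarith [hθ.1, hφ.2]) (by linarith [hθ.2, hφ.1])).1 h
  linarith

/-- Lines of distinct directions meet in at most one point. -/
lemma eq_of_mem_lineThru {i j : MPt} (hi : i.2 ∈ Set.Ico 0 Real.pi)
    (hj : j.2 ∈ Set.Ico 0 Real.pi) (hne : i.2 ≠ j.2) {q r : Pt}
    (hqi : q ∈ lineThru i) (hqj : q ∈ lineThru j) (hri : r ∈ lineThru i) (hrj : r ∈ lineThru j) :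
    q = r := by
  obtain ⟨a, rfl⟩ := hqi
  obtain ⟨b, hb⟩ := hqj
  obtain ⟨c, rfl⟩ := hri
  obtain ⟨d, hd⟩ := hrj
  have h : (a - c) • dirVec i.2 = (b - d) • dirVec j.2 := by
    rw [sub_smul, sub_smul, ← add_sub_add_left_eq_sub _ _ i.1, hb, hd, add_sub_add_left_eq_sub]
  rw [sub_eq_zero.mp (eq_zero_of_smul_dirVec_eq hi hj hne h)]

lemma interPt_eq {i j : MPt} (hi : i.2 ∈ Set.Ico 0 Real.pi)
    (hj : j.2 ∈ Set.Ico 0 Real.pi) (hne : i.2 ≠ j.2) {q : Pt}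
    (hqi : q ∈ lineThru i) (hqj : q ∈ lineThru j) : interPt i j = q := by
  have h : (lineThru i ∩ lineThru j).Nonempty := ⟨q, hqi, hqj⟩
  rw [interPt, dif_pos h]
  exact eq_of_mem_lineThru hi hj hne h.choose_spec.1 h.choose_spec.2 hqi hqj

lemma mem_lineThru_of_mem_S0 {p : MPt} {r : ℝ≥0∞} {q : Pt} (h : q ∈ S0 p r) : q ∈ lineThru p := by
  obtain ⟨t, -, rfl⟩ := h
  exact ⟨t, rfl⟩

lemma edist_lt_of_mem_S0 {p : MPt} {r : ℝ≥0∞} {q : Pt} (h : q ∈ S0 p r) : edist p.1 q < r := by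
  obtain ⟨t, ht, rfl⟩ := h
  rwa [edist_add_smul_dirVec]

lemma dD_lt_of_mem_S0 {i j : MPt} (hi : i.2 ∈ Set.Ico 0 Real.pi)
    (hj : j.2 ∈ Set.Ico 0 Real.pi) (hne : i.2 ≠ j.2) {r : ℝ≥0∞} {q : Pt}
    (hqi : q ∈ S0 i r) (hqj : q ∈ lineThru j) : dD i j < r := by
  rw [dD, if_neg hne, interPt_eq hi hj hne (mem_lineThru_of_mem_S0 hqi) hqj]
  exact edist_lt_of_mem_S0 hqi

/-- Marked points with the same direction whose lines meet lie on a common line. -/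
lemma dD_of_dir_eq {i j : MPt} (h : i.2 = j.2) {q : Pt} (hqi : q ∈ lineThru i)
    (hqj : q ∈ lineThru j) : dD i j = edist i.1 j.1 / 2 := by
  obtain ⟨a, rfl⟩ := hqi
  obtain ⟨b, hb⟩ := hqj
  have hmem : j.1 ∈ lineThru i :=
    ⟨a - b, by rw [sub_smul, ← add_sub_assoc, hb, h, add_sub_cancel_right]⟩
  rw [dD, if_pos h, if_pos hmem]

/-- Lemma 4.17: a fixed point of `T₂` is a hard-segment function. -/
theorem statement14 (A : Set MPt) (hA : MarkedLocFin A) (hD : CondD A)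
    (f : MPt → ℝ≥0∞) (hfix : Set.EqOn f (T2 A f) A) :
    IsHS A f := by
  intro i hi j hj hij
  rw [Set.disjoint_left]
  intro q hqi hqj
  have hli := mem_lineThru_of_mem_S0 hqi
  have hlj := mem_lineThru_of_mem_S0 hqj
  by_cases hθ : i.2 = j.2
  · have h₁ := dD_of_dir_eq hθ hli hlj
    have h₂ := dD_of_dir_eq hθ.symm hlj hli
    have hfin : edist i.1 j.1 / 2 ≠ ⊤ := ENNReal.div_ne_top (edist_ne_top _ _) (by norm_num)
    have heq : dD i j = dD j i := by rw [h₁, h₂, edist_comm]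
    have hne : (i, j) ≠ (j, i) := fun h => hij (Prod.ext_iff.mp h).1
    exact hD i hi j hj j hj i hi hij hij.symm hne (h₁ ▸ hfin) (heq ▸ h₁ ▸ hfin) heq
  · have hdi := dD_lt_of_mem_S0 (hA.1 i hi) (hA.1 j hj) hθ hqi hlj
    have hdj := dD_lt_of_mem_S0 (hA.1 j hj) (hA.1 i hi) (Ne.symm hθ) hqj hli
    have hfi : f i ≤ max (dD i j) (dD j i) :=
      (hfix hi).trans_le (sInf_le ⟨j, hj, hij.symm, rfl, hdj.le⟩)
    have hfj : f j ≤ max (dD j i) (dD i j) :=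
      (hfix hj).trans_le (sInf_le ⟨i, hi, hij, rfl, hdi.le⟩)
    rcases le_total (dD i j) (dD j i) with h | h
    · exact (hfj.trans_eq (max_eq_left h)).not_gt hdj
    · exact (hfi.trans_eq (max_eq_left h)).not_gt hdi

end Lilypond
end
end
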